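/- arXiv:0803.0835 — 3 statements merged into one kernel-verified Lean document; each statement's English description precedes it below -/
import Mathlib

section
/- Let p ≥ 1 and let (Y_t)_{t∈ℤ} and, for each n ∈ ℕ, (Y_t^{(n)})_{t∈ℤ} be real-valued stationary Markov processes of order p, defined on probability spaces (Ω, 𝒜, P) and (Ω_n, 𝒜_n, P_n) respectively. Let π(y, ·) and π_n(y, ·), y ∈ ℝ^p, denote versions of the one-step transition kernels, i.e. regular conditional distributions of Y_t given (Y_{t−1},…,Y_{t−p}) = y and of Y_t^{(n)} given (Y_{t−1}^{(n)},…,Y_{t−p}^{(n)}) = y. Assume: (i) for every compact K ⊆ ℝ^p, sup_{y∈K} d(π_n(y, ·), π(y, ·)) → 0 as n → ∞; (ii) for every y ∈ ℝ^p, sup_{ỹ: ‖ỹ − y‖ ≤ δ} d(π(y, ·), π(ỹ, ·)) → 0 as δ → 0; (iii) the family of laws of Y₁^{(n)} under P_n, n ∈ ℕ, is tight; (iv) the law of (Y₁,…,Y_p) under P is the unique stationary distribution corresponding to the kernel π. Then for every k ∈ ℕ, the law of (Y₁^{(n)},…,Y_k^{(n)}) under P_n converges weakly to the law of (Y₁,…,Y_k)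 under P. -/
open MeasureTheory ProbabilityTheory Filter

/-- The distance `d(μ, ν) = inf_{X∼μ, Y∼ν} E[‖X−Y‖ ∧ 1]`, the infimum being taken over all
couplings of `μ` and `ν`. -/
noncomputable def couplingDist {E : Type*} [MeasurableSpace E] [PseudoMetricSpace E]
    (μ ν : Measure E) : ℝ :=
  sInf {r : ℝ | ∃ π : Measure (E × E), IsProbabilityMeasure π ∧
    π.map Prod.fst = μ ∧ π.map Prod.snd = ν ∧ r = ∫ z, min (dist z.1 z.2) 1 ∂π}

/-- Updating the state `(y₁,…,y_p)` (newest coordinate first) with a new value `z`: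
the new state is `(z, y₁,…,y_{p−1})`. -/
def stepMap (p : ℕ) : ((Fin p → ℝ) × ℝ) → (Fin p → ℝ) :=
  fun yz i => if h : (i : ℕ) = 0 then yz.2
    else yz.1 ⟨(i : ℕ) - 1, by have := i.isLt; omega⟩

/-- `(Y_t)_{t∈ℤ}` is a Markov process of order `p` with one-step transition kernel `κ`:
for every `t` and Borel `B`, `P(Y_t ∈ B | σ(Y_s, s < t)) = κ((Y_{t−1},…,Y_{t−p}), B)` a.s.
(This expresses simultaneously the Markov property of order `p` and that `κ` is a version
of the regular conditional distribution of `Y_t` given `(Y_{t−1},…,Y_{t−p})`.) -/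
def IsMarkovOfOrder {Ω : Type*} [MeasurableSpace Ω] (P : Measure Ω) (p : ℕ)
    (Y : ℤ → Ω → ℝ) (κ : ProbabilityTheory.Kernel (Fin p → ℝ) ℝ) : Prop :=
  ∀ t : ℤ, ∀ B : Set ℝ, MeasurableSet B →
    (P[(fun ω => Set.indicator B (fun _ => (1 : ℝ)) (Y t ω)) |
        ⨆ s : {s : ℤ // s < t}, MeasurableSpace.comap (Y (s : ℤ)) inferInstance])
      =ᵐ[P] fun ω => (κ (fun i : Fin p => Y (t - 1 - (i : ℤ)) ω) B).toReal

/-- `μ` is a stationary distribution for the order-`p` transition kernel `κ`: if the state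
has law `μ` and a new value is generated from `κ`, the updated state again has law `μ`. -/
def IsStationaryDist (p : ℕ) (κ : ProbabilityTheory.Kernel (Fin p → ℝ) ℝ)
    (μ : Measure (Fin p → ℝ)) : Prop :=
  (μ.compProd κ).map (stepMap p) = μ

open scoped Topology

/-- A function whose increments are dominated by the truncated distance has integrals that are
Lipschitz with respect to the coupling distance. -/
lemma abs_integral_sub_integral_le_of_couplingDist_lt {E : Type*} [MeasurableSpace E]
    [PseudoMetricSpace E] [OpensMeasurableSpace E] [SecondCountableTopology E]
    {μ ν : Measure E} [IsProbabilityMeasure μ] [IsProbabilityMeasure ν]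
    {f : E → ℝ} {C δ : ℝ} (hC : 0 ≤ C) (hfm : Measurable f)
    (hf : ∀ x y, |f x - f y| ≤ C * min (dist x y) 1) (hδ : couplingDist μ ν < δ) :
    |∫ x, f x ∂μ - ∫ x, f x ∂ν| ≤ C * δ := by
  have hne : {r : ℝ | ∃ π : Measure (E × E), IsProbabilityMeasure π ∧ π.map Prod.fst = μ ∧
      π.map Prod.snd = ν ∧ r = ∫ z, min (dist z.1 z.2) 1 ∂π}.Nonempty :=
    ⟨_, μ.prod ν, inferInstance, by simp [Measure.map_fst_prod], by simp [Measure.map_snd_prod],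
      rfl⟩
  obtain ⟨r, ⟨π, hπ, h1, h2, rfl⟩, hr⟩ := exists_lt_of_csInf_lt hne hδ
  obtain ⟨x₀⟩ : Nonempty E := μ.nonempty_of_neZero
  have hbound : ∀ x, ‖f x‖ ≤ |f x₀| + C := fun x => by
    have h := hf x x₀
    have h' : C * min (dist x x₀) 1 ≤ C * 1 := by gcongr; exact min_le_right _ _
    have := abs_sub_abs_le_abs_sub (f x) (f x₀)
    rw [Real.norm_eq_abs]; linarith
  have hi1 : Integrable (fun z : E × E => f z.1) π :=
    .of_bound (hfm.comp measurable_fst).aestronglyMeasurable _ (.of_forall fun z => hbound z.1)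
  have hi2 : Integrable (fun z : E × E => f z.2) π :=
    .of_bound (hfm.comp measurable_snd).aestronglyMeasurable _ (.of_forall fun z => hbound z.2)
  have hi3 : Integrable (fun z : E × E => min (dist z.1 z.2) 1) π := by
    refine .of_bound (C := 1) (by fun_prop) (.of_forall fun z => ?_)
    rw [Real.norm_of_nonneg (by positivity)]
    exact min_le_right _ _
  rw [← h1, ← h2, integral_map measurable_fst.aemeasurable hfm.aestronglyMeasurable,
    integral_map measurable_snd.aemeasurable hfm.aestronglyMeasurable, ← integral_sub hi1 hi2]
  calc |∫ z, (f z.1 - f z.2) ∂π| ≤ ∫ z, |f z.1 - f z.2| ∂π := abs_integral_le_integral_abs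
    _ ≤ ∫ z, C * min (dist z.1 z.2) 1 ∂π :=
        integral_mono (hi1.sub hi2).abs (hi3.const_mul C) fun z => hf _ _
    _ = C * ∫ z, min (dist z.1 z.2) 1 ∂π := integral_const_mul _ _
    _ ≤ C * δ := by gcongr

/-- The integral of a bounded Lipschitz function against a kernel which is continuous for the
coupling distance is continuous. -/
lemma continuous_integral_of_couplingDist {E F : Type*} [MeasurableSpace E] [PseudoMetricSpace E]
    [MeasurableSpace F] [PseudoMetricSpace F] [OpensMeasurableSpace F]
    [SecondCountableTopology F] {κ : Kernel E F} [IsMarkovKernel κ]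
    (hκ : ∀ y : E, ∀ η : ℝ, 0 < η → ∃ δ : ℝ, 0 < δ ∧
      ∀ y' : E, dist y' y ≤ δ → couplingDist (κ y) (κ y') < η)
    {f : E × F → ℝ} {C M : ℝ} {L : NNReal} (hC : 0 ≤ C) (hL : LipschitzWith L f)
    (hM : ∀ z, ‖f z‖ ≤ M)
    (hf : ∀ y x x', |f (y, x) - f (y, x')| ≤ C * min (dist x x') 1) :
    Continuous fun y => ∫ x, f (y, x) ∂(κ y) := by
  have hmeas : ∀ y, Measurable fun x => f (y, x) := fun y =>
    (hL.continuous.comp (by fun_prop : Continuous fun x : F => (y, x))).measurable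
  have hint : ∀ y y', Integrable (fun x => f (y, x)) (κ y') := fun y y' =>
    .of_bound (hmeas y).aestronglyMeasurable M (.of_forall fun x => hM _)
  rw [Metric.continuous_iff]
  intro y ε hε
  obtain ⟨δ, hδ, h⟩ := hκ y (ε / (2 * (C + 1))) (by positivity)
  refine ⟨min δ (ε / (2 * (L + 1))), by positivity, fun y' hy' => ?_⟩
  have h1 : |∫ x, f (y, x) ∂(κ y) - ∫ x, f (y, x) ∂(κ y')| ≤ C * (ε / (2 * (C + 1))) :=
    abs_integral_sub_integral_le_of_couplingDist_lt hC (hmeas y) (hf y)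
      (h y' (hy'.le.trans (min_le_left _ _)))
  have h2 : |∫ x, f (y', x) ∂(κ y') - ∫ x, f (y, x) ∂(κ y')| ≤ L * dist y' y := by
    rw [← integral_sub (hint _ _) (hint _ _)]
    have := norm_integral_le_of_norm_le_const (μ := κ y') (C := L * dist y' y)
      (f := fun x => f (y', x) - f (y, x)) (.of_forall fun x => by
        have := hL.dist_le_mul (y', x) (y, x)
        simpa [Prod.dist_eq, ← Real.dist_eq] using this)
    simpa using this
  have h3 : C * (ε / (2 * (C + 1))) < ε / 2 := by
    rw [show C * (ε / (2 * (C + 1))) = ε / 2 * (C / (C + 1)) by field_simp]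
    exact mul_lt_of_lt_one_right (by positivity) ((div_lt_one (by positivity)).2 (by linarith))
  have h4 : L * dist y' y ≤ ε / 2 := by
    have : dist y' y ≤ ε / (2 * (L + 1)) := hy'.le.trans (min_le_right _ _)
    calc L * dist y' y ≤ (L + 1) * (ε / (2 * (L + 1))) := by gcongr; linarith
      _ = ε / 2 := by field_simp
  rw [Real.dist_eq]
  rw [abs_sub_comm] at h1
  have := abs_sub_le (∫ x, f (y', x) ∂(κ y')) (∫ x, f (y, x) ∂(κ y')) (∫ x, f (y, x) ∂(κ y))
  linarith

/-- The composition-product of a probability measure and a Markov kernel, as a probability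
measure. -/
noncomputable def probCompProd {E F : Type*} [MeasurableSpace E] [MeasurableSpace F]
    (μ : ProbabilityMeasure E) (κ : Kernel E F) [IsMarkovKernel κ] : ProbabilityMeasure (E × F) :=
  ⟨(μ : Measure E).compProd κ, inferInstance⟩

lemma coe_probCompProd {E F : Type*} [MeasurableSpace E] [MeasurableSpace F]
    (μ : ProbabilityMeasure E) (κ : Kernel E F) [IsMarkovKernel κ] :
    (probCompProd μ κ : Measure (E × F)) = (μ : Measure E).compProd κ := rfl

/-- Weak convergence of composition-products: if the initial laws are tight and converge weakly,
and the kernels converge locally uniformly to a continuous kernel for the coupling distance, then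
the joint laws converge weakly. -/
lemma tendsto_compProd_of_couplingDist {E F : Type*} [MeasurableSpace E] [PseudoMetricSpace E]
    [BorelSpace E] [T2Space E] [SecondCountableTopology E]
    [MeasurableSpace F] [PseudoMetricSpace F] [OpensMeasurableSpace F]
    [SecondCountableTopology F]
    {κ : Kernel E F} [IsMarkovKernel κ] {κs : ℕ → Kernel E F} [∀ n, IsMarkovKernel (κs n)]
    {μ : ProbabilityMeasure E} {μs : ℕ → ProbabilityMeasure E}
    (hconv : ∀ K : Set E, IsCompact K → ∀ δ : ℝ, 0 < δ →
      ∀ᶠ n in atTop, ∀ y ∈ K, couplingDist ((κs n) y) (κ y) < δ)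
    (hκ : ∀ y : E, ∀ η : ℝ, 0 < η → ∃ δ : ℝ, 0 < δ ∧
      ∀ y' : E, dist y' y ≤ δ → couplingDist (κ y) (κ y') < η)
    (htight : IsTightMeasureSet (Set.range fun n => (μs n : Measure E)))
    (hμ : Tendsto μs atTop (𝓝 μ)) :
    Tendsto (fun n => probCompProd (μs n) (κs n)) atTop (𝓝 (probCompProd μ κ)) := by
  rw [tendsto_iff_forall_lipschitz_integral_tendsto]
  rintro f ⟨B, hB⟩ ⟨L, hL⟩
  obtain ⟨z₀⟩ : Nonempty (E × F) := ((μ : Measure E).compProd κ).nonempty_of_neZero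
  set M : ℝ := |f z₀| + B
  have hM : ∀ z, ‖f z‖ ≤ M := fun z => by
    have := hB z z₀
    rw [Real.dist_eq] at this
    have := abs_sub_abs_le_abs_sub (f z) (f z₀)
    rw [Real.norm_eq_abs]; linarith
  have hM0 : 0 ≤ M := (norm_nonneg _).trans (hM z₀)
  set C : ℝ := max L B
  have hC : 0 ≤ C := L.2.trans (le_max_left _ _)
  have hf : ∀ y x x', |f (y, x) - f (y, x')| ≤ C * min (dist x x') 1 := fun y x x' => by
    rw [← Real.dist_eq, mul_min_of_nonneg _ _ hC, mul_one]
    refine le_min ?_ ((hB _ _).trans (le_max_right _ _))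
    calc dist (f (y, x)) (f (y, x')) ≤ L * dist x x' := by
          simpa [Prod.dist_eq] using hL.dist_le_mul (y, x) (y, x')
      _ ≤ C * dist x x' := by gcongr; exact le_max_left _ _
  have hfm : Measurable f := hL.continuous.measurable
  have hFbound : ∀ (η : Kernel E F) [IsMarkovKernel η] (y : E), ‖∫ x, f (y, x) ∂(η y)‖ ≤ M :=
    fun η _ y => by
      simpa using norm_integral_le_of_norm_le_const (μ := η y) (C := M)
        (f := fun x => f (y, x)) (.of_forall fun x => hM _)
  have hFmeas : ∀ (η : Kernel E F) [IsMarkovKernel η],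
      StronglyMeasurable fun y => ∫ x, f (y, x) ∂(η y) := fun η _ =>
    hfm.stronglyMeasurable.integral_kernel_prod_right'
  have hFint : ∀ (η : Kernel E F) [IsMarkovKernel η] (ν : ProbabilityMeasure E),
      Integrable (fun y => ∫ x, f (y, x) ∂(η y)) (ν : Measure E) := fun η _ ν =>
    .of_bound (hFmeas η).aestronglyMeasurable M (.of_forall (hFbound η))
  have hcomp : ∀ (η : Kernel E F) [IsMarkovKernel η] (ν : ProbabilityMeasure E),
      ∫ z, f z ∂((ν : Measure E).compProd η) = ∫ y, ∫ x, f (y, x) ∂(η y) ∂(ν : Measure E) :=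
    fun η _ ν => Measure.integral_compProd
      (.of_bound hfm.aestronglyMeasurable M (.of_forall hM))
  simp only [coe_probCompProd, hcomp]
  have hlim : Tendsto (fun n => ∫ y, ∫ x, f (y, x) ∂(κ y) ∂(μs n : Measure E)) atTop
      (𝓝 (∫ y, ∫ x, f (y, x) ∂(κ y) ∂(μ : Measure E))) :=
    (ProbabilityMeasure.tendsto_iff_forall_integral_tendsto.1 hμ)
      (BoundedContinuousFunction.ofNormedAddCommGroup _
        (continuous_integral_of_couplingDist hκ hC hL hM hf) M (hFbound κ))
  have hdiff : Tendsto (fun n => ∫ y, ((∫ x, f (y, x) ∂(κs n y)) - ∫ x, f (y, x) ∂(κ y))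
      ∂(μs n : Measure E)) atTop (𝓝 0) := by
    rw [Metric.tendsto_nhds]
    intro ε hε
    set δ : ℝ := ε / (C + 2 * M + 1) with hδdef
    have hδ : 0 < δ := by positivity
    obtain ⟨K, hK, hKμ⟩ := isTightMeasureSet_iff_exists_isCompact_measure_compl_le.1 htight
      (ENNReal.ofReal δ) (by simpa using hδ)
    filter_upwards [hconv K hK δ hδ] with n hn
    have hKm : MeasurableSet Kᶜ := hK.measurableSet.compl
    have hKn : (μs n : Measure E).real Kᶜ ≤ δ :=
      ENNReal.toReal_le_of_le_ofReal hδ.le (hKμ _ ⟨n, rfl⟩)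
    have hpt : ∀ y, |(∫ x, f (y, x) ∂(κs n y)) - ∫ x, f (y, x) ∂(κ y)|
        ≤ C * δ + Kᶜ.indicator (fun _ => 2 * M) y := fun y => by
      by_cases hy : y ∈ K
      · simpa [hy] using abs_integral_sub_integral_le_of_couplingDist_lt hC
          (hfm.comp measurable_prodMk_left) (hf y) (hn y hy)
      · have h1 := hFbound (κs n) y
        have h2 := hFbound κ y
        have h3 := norm_sub_le (∫ x, f (y, x) ∂(κs n y)) (∫ x, f (y, x) ∂(κ y))
        rw [Set.indicator_of_mem (by simpa using hy), ← Real.norm_eq_abs]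
        nlinarith [mul_nonneg hC hδ.le]
    rw [dist_zero_right, Real.norm_eq_abs]
    have hind : Integrable (Kᶜ.indicator fun _ => 2 * M) (μs n : Measure E) :=
      (integrable_const _).indicator hKm
    calc _ ≤ ∫ y, |(∫ x, f (y, x) ∂(κs n y)) - ∫ x, f (y, x) ∂(κ y)| ∂(μs n : Measure E) :=
          abs_integral_le_integral_abs
      _ ≤ ∫ y, (C * δ + Kᶜ.indicator (fun _ => 2 * M) y) ∂(μs n : Measure E) :=
          integral_mono ((hFint (κs n) _).sub (hFint κ _)).abs
            ((integrable_const _).add hind) hpt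
      _ = C * δ + (μs n : Measure E).real Kᶜ * (2 * M) := by
          rw [integral_add (integrable_const _) hind, integral_indicator_const _ hKm]
          simp
      _ ≤ C * δ + δ * (2 * M) := by gcongr
      _ < (C + 2 * M + 1) * δ := by linarith
      _ = ε := by rw [hδdef]; field_simp
  have := hdiff.add hlim
  rw [zero_add] at this
  refine this.congr fun n => ?_
  rw [integral_sub (hFint (κs n) _) (hFint κ _), sub_add_cancel]

/-- A family of laws on a finite power of `ℝ` is tight if all its one-dimensional marginals are
dominated outside a common compact set. -/
lemma isTightMeasureSet_range_of_forall_marginal {ι J X : Type*} [Fintype J]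
    [TopologicalSpace X] [MeasurableSpace X] {μ : ι → Measure (J → X)}
    (h : ∀ η : ℝ, 0 < η → ∃ K : Set X, IsCompact K ∧
      ∀ i j, μ i {v | v j ∉ K} ≤ ENNReal.ofReal η) :
    IsTightMeasureSet (Set.range μ) := by
  rw [isTightMeasureSet_iff_exists_isCompact_measure_compl_le]
  intro ε hε
  obtain ⟨ε', hε', hle⟩ : ∃ ε' : ℝ, 0 < ε' ∧ ENNReal.ofReal ε' ≤ ε := by
    obtain ⟨q, hq, hqε⟩ := ENNReal.lt_iff_exists_nnreal_btwn.1 hε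
    exact ⟨q, by simpa using hq, by simpa using hqε.le⟩
  obtain ⟨K, hK, hKμ⟩ := h (ε' / (Fintype.card J + 1)) (by positivity)
  refine ⟨Set.univ.pi fun _ => K, isCompact_univ_pi fun _ => hK, ?_⟩
  rintro _ ⟨i, rfl⟩
  have hsub : (Set.univ.pi fun _ : J => K)ᶜ ⊆ ⋃ j, {v : J → X | v j ∉ K} := fun v hv => by
    simpa [Set.mem_pi] using hv
  calc μ i (Set.univ.pi fun _ => K)ᶜ ≤ ∑ j, μ i {v | v j ∉ K} :=
        (measure_mono hsub).trans (measure_iUnion_fintype_le _ _)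
    _ ≤ ∑ _j : J, ENNReal.ofReal (ε' / (Fintype.card J + 1)) :=
        Finset.sum_le_sum fun j _ => hKμ i j
    _ = ENNReal.ofReal (Fintype.card J * (ε' / (Fintype.card J + 1))) := by
        rw [Finset.sum_const, Finset.card_univ, nsmul_eq_mul,
          ENNReal.ofReal_mul (Nat.cast_nonneg _), ENNReal.ofReal_natCast]
    _ ≤ ENNReal.ofReal ε' := by
        refine ENNReal.ofReal_le_ofReal ?_
        rw [← mul_div_assoc, div_le_iff₀ (by positivity)]
        nlinarith
    _ ≤ ε := hle

/-- The vector `(Y_{t-1}, …, Y_{t-m})` of the `m` values before time `t`, newest first. -/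
def pastVec {Ω : Type*} (Y : ℤ → Ω → ℝ) (m : ℕ) (t : ℤ) (ω : Ω) : Fin m → ℝ :=
  fun i => Y (t - 1 - (i : ℤ)) ω

lemma measurable_pastVec {Ω : Type*} [MeasurableSpace Ω] {Y : ℤ → Ω → ℝ}
    (hY : ∀ t, Measurable (Y t)) (m : ℕ) (t : ℤ) : Measurable (pastVec Y m t) :=
  measurable_pi_lambda _ fun _ => hY _

/-- The law of the `m` values before time `t`. -/
noncomputable def pastLaw {Ω : Type*} [MeasurableSpace Ω] (P : Measure Ω)
    [IsProbabilityMeasure P] {Y : ℤ → Ω → ℝ} (hY : ∀ t, Measurable (Y t)) (m : ℕ) (t : ℤ) :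
    ProbabilityMeasure (Fin m → ℝ) :=
  ⟨P.map (pastVec Y m t), Measure.isProbabilityMeasure_map (measurable_pastVec hY m t).aemeasurable⟩

/-- The law of the past vector of a stationary process does not depend on time. -/
lemma pastLaw_eq_of_stationary {Ω : Type*} [MeasurableSpace Ω] {P : Measure Ω}
    [IsProbabilityMeasure P] {Y : ℤ → Ω → ℝ} (hY : ∀ t, Measurable (Y t))
    (hstat : ∀ (m : ℕ) (t s : ℤ),
      Measure.map (fun ω => fun i : Fin m => Y (t + (i : ℤ)) ω) P
        = Measure.map (fun ω => fun i : Fin m => Y (s + (i : ℤ)) ω) P)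
    (m : ℕ) (t s : ℤ) : pastLaw P hY m t = pastLaw P hY m s := by
  have key : ∀ t, P.map (pastVec Y m t) =
      (P.map (fun ω => fun i : Fin m => Y (t - m + (i : ℤ)) ω)).map
        (fun v i => v (Fin.rev i)) := fun t => by
    rw [Measure.map_map (by fun_prop) (measurable_pi_lambda _ fun _ => hY _)]
    congr 1
    funext ω i
    have hi : ((Fin.rev i : Fin m) : ℤ) = m - 1 - i := by
      rw [Fin.val_rev]; omega
    simp only [pastVec, Function.comp, hi]
    congr 1; ring
  exact Subtype.ext (by simp only [pastLaw]; rw [key t, key s, hstat m (t - m) (s - m)])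

/-- The σ-algebra generated by the values of the process before time `t`. -/
abbrev pastSigma {Ω : Type*} (Y : ℤ → Ω → ℝ) (t : ℤ) : MeasurableSpace Ω :=
  ⨆ s : {s : ℤ // s < t}, MeasurableSpace.comap (Y (s : ℤ)) inferInstance

lemma measurable_pastVec_pastSigma {Ω : Type*} (Y : ℤ → Ω → ℝ) (m : ℕ) (t : ℤ) :
    Measurable[pastSigma Y t] (pastVec Y m t) := by
  refine @measurable_pi_lambda _ _ _ (pastSigma Y t) _ _ fun i => ?_
  have hle : MeasurableSpace.comap (Y (t - 1 - (i : ℤ))) inferInstance ≤ pastSigma Y t :=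
    le_iSup (fun s : {s : ℤ // s < t} => MeasurableSpace.comap (Y (s : ℤ)) inferInstance)
      ⟨t - 1 - (i : ℤ), by omega⟩
  exact (comap_measurable _).mono hle le_rfl

/-- The Markov property in integrated form: the joint law of the past vector and the present
value is the composition-product of the law of the past vector with the transition kernel. -/
lemma map_prodMk_pastVec_eq_compProd {Ω : Type*} {mΩ : MeasurableSpace Ω} {P : Measure Ω}
    [IsProbabilityMeasure P] {p : ℕ} {Y : ℤ → Ω → ℝ} (hY : ∀ t, Measurable (Y t))
    {κ : Kernel (Fin p → ℝ) ℝ} [IsMarkovKernel κ] (hM : IsMarkovOfOrder P p Y κ)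
    {m : ℕ} (hpm : p ≤ m) {r : (Fin m → ℝ) → (Fin p → ℝ)} (hr : Measurable r)
    (hr' : ∀ v i, r v i = v (Fin.castLE hpm i)) (t : ℤ) :
    P.map (fun ω => (pastVec Y m t ω, Y t ω))
      = (pastLaw P hY m t : Measure (Fin m → ℝ)).compProd (κ.comap r hr) := by
  have hpast := measurable_pastVec hY m t
  have : IsProbabilityMeasure (P.map fun ω => (pastVec Y m t ω, Y t ω)) :=
    Measure.isProbabilityMeasure_map (hpast.prodMk (hY t)).aemeasurable
  refine Measure.ext_prod fun {A B} hA hB => ?_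
  rw [Measure.map_apply (hpast.prodMk (hY t)) (hA.prod hB),
    Measure.compProd_apply_prod hA hB]
  simp only [pastLaw, ProbabilityMeasure.coe_mk, Kernel.comap_apply]
  have hκB : Measurable fun v => κ (r v) B := (κ.measurable_coe hB).comp hr
  rw [setLIntegral_map hA hκB hpast]
  have hle : pastSigma Y t ≤ mΩ := iSup_le fun s => (hY s).comap_le
  have hS : MeasurableSet[pastSigma Y t] (pastVec Y m t ⁻¹' A) :=
    measurable_pastVec_pastSigma Y m t hA
  have hrpast : ∀ ω, r (pastVec Y m t ω) = fun i : Fin p => Y (t - 1 - (i : ℤ)) ω := fun ω => by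
    funext i; simp [hr', pastVec]
  have hint : Integrable (fun ω => B.indicator (fun _ => (1 : ℝ)) (Y t ω)) P :=
    .of_bound ((measurable_const.indicator hB).comp (hY t)).aestronglyMeasurable 1
      (.of_forall fun ω => by by_cases h : Y t ω ∈ B <;> simp [h])
  have hcond := setIntegral_condExp hle hint hS
  have hker : P[fun ω => B.indicator (fun _ => (1 : ℝ)) (Y t ω) | pastSigma Y t]
      =ᵐ[P] fun ω => (κ (r (pastVec Y m t ω)) B).toReal := by
    simpa only [hrpast] using hM t B hB
  rw [setIntegral_congr_ae (hle _ hS) (hker.mono fun ω h _ => h)] at hcond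
  have hleft : ∫ ω in pastVec Y m t ⁻¹' A, B.indicator (fun _ => (1 : ℝ)) (Y t ω) ∂P
      = P.real ((fun ω => (pastVec Y m t ω, Y t ω)) ⁻¹' A ×ˢ B) := by
    have : (fun ω => B.indicator (fun _ => (1 : ℝ)) (Y t ω))
        = (Y t ⁻¹' B).indicator fun _ => (1 : ℝ) := rfl
    rw [this, integral_indicator_const _ (hY t hB), measureReal_restrict_apply (hY t hB),
      smul_eq_mul, mul_one, Set.mk_preimage_prod, Set.inter_comm]
  have hκpast : Measurable fun ω => κ (r (pastVec Y m t ω)) B := hκB.comp hpast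
  rw [hleft, integral_toReal hκpast.aemeasurable (.of_forall fun ω => measure_lt_top _ _)] at hcond
  refine ((ENNReal.toReal_eq_toReal_iff' ?_ (measure_ne_top _ _)).1 hcond).symm
  refine ne_top_of_le_ne_top (measure_ne_top P (pastVec Y m t ⁻¹' A)) ?_
  calc ∫⁻ ω in pastVec Y m t ⁻¹' A, κ (r (pastVec Y m t ω)) B ∂P
      ≤ ∫⁻ _ in pastVec Y m t ⁻¹' A, 1 ∂P := lintegral_mono fun ω => prob_le_one
    _ = P (pastVec Y m t ⁻¹' A) := by simp

lemma continuous_finCons_swap (m : ℕ) :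
    Continuous fun z : (Fin m → ℝ) × ℝ => (Fin.cons z.2 z.1 : Fin (m + 1) → ℝ) :=
  Continuous.finCons (A := fun _ => ℝ) continuous_snd continuous_fst

/-- The law of the past vector extended by one coordinate, obtained from the kernel. -/
lemma pastLaw_succ {Ω : Type*} [MeasurableSpace Ω] {P : Measure Ω}
    [IsProbabilityMeasure P] {p : ℕ} {Y : ℤ → Ω → ℝ} (hY : ∀ t, Measurable (Y t))
    {κ : Kernel (Fin p → ℝ) ℝ} [IsMarkovKernel κ] (hM : IsMarkovOfOrder P p Y κ)
    {m : ℕ} (hpm : p ≤ m) {r : (Fin m → ℝ) → (Fin p → ℝ)} (hr : Measurable r)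
    (hr' : ∀ v i, r v i = v (Fin.castLE hpm i)) (t : ℤ) :
    (pastLaw P hY (m + 1) (t + 1) : Measure (Fin (m + 1) → ℝ))
      = ((pastLaw P hY m t : Measure (Fin m → ℝ)).compProd (κ.comap r hr)).map
          (fun z => (Fin.cons z.2 z.1 : Fin (m + 1) → ℝ)) := by
  have hcons := (continuous_finCons_swap m).measurable
  rw [← map_prodMk_pastVec_eq_compProd hY hM hpm hr hr' t,
    Measure.map_map hcons ((measurable_pastVec hY m t).prodMk (hY t))]
  simp only [pastLaw, ProbabilityMeasure.coe_mk]
  congr 1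
  funext ω i
  refine Fin.cases ?_ (fun j => ?_) i
  · simp [pastVec]
  · simp only [pastVec, Function.comp, Fin.cons_succ, Fin.val_succ]
    congr 1; push_cast; ring

lemma continuous_stepMap (p : ℕ) : Continuous (stepMap p) := by
  refine continuous_pi fun i => ?_
  by_cases h : (i : ℕ) = 0
  · simpa [stepMap, h] using continuous_snd
  · simp only [stepMap, h, dite_false]
    fun_prop

/-- One step of the transition kernel moves the law of the past vector forward in time. -/
lemma map_stepMap_compProd_pastLaw {Ω : Type*} [MeasurableSpace Ω] {P : Measure Ω}
    [IsProbabilityMeasure P] {p : ℕ} {Y : ℤ → Ω → ℝ} (hY : ∀ t, Measurable (Y t))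
    {κ : Kernel (Fin p → ℝ) ℝ} [IsMarkovKernel κ] (hM : IsMarkovOfOrder P p Y κ) (t : ℤ) :
    ((pastLaw P hY p t : Measure (Fin p → ℝ)).compProd κ).map (stepMap p)
      = pastLaw P hY p (t + 1) := by
  have h := map_prodMk_pastVec_eq_compProd hY hM le_rfl measurable_id (fun v i => rfl) t
  rw [Kernel.comap_id] at h
  rw [← h, Measure.map_map (continuous_stepMap p).measurable
    ((measurable_pastVec hY p t).prodMk (hY t))]
  simp only [pastLaw, ProbabilityMeasure.coe_mk]
  congr 1
  funext ω i
  by_cases hi : (i : ℕ) = 0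
  · simp [stepMap, pastVec, hi]
  · simp only [stepMap, pastVec, Function.comp, hi, dite_false]
    congr 1
    rw [Nat.cast_sub (by omega)]; push_cast; ring

/-- The laws of the past vectors of stationary processes are tight if the one-dimensional
marginals are. -/
lemma isTightMeasureSet_range_pastLaw {Ωn : ℕ → Type*} [∀ n, MeasurableSpace (Ωn n)]
    {Pn : ∀ n, Measure (Ωn n)} [∀ n, IsProbabilityMeasure (Pn n)]
    {Yn : ∀ n, ℤ → Ωn n → ℝ} (hYn : ∀ n t, Measurable (Yn n t))
    (hstat : ∀ n (m : ℕ) (t s : ℤ),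
      Measure.map (fun ω => fun i : Fin m => Yn n (t + (i : ℤ)) ω) (Pn n)
        = Measure.map (fun ω => fun i : Fin m => Yn n (s + (i : ℤ)) ω) (Pn n))
    (htight : ∀ η : ℝ, 0 < η → ∃ K : Set ℝ, IsCompact K ∧
      ∀ n, Measure.map (Yn n 1) (Pn n) Kᶜ ≤ ENNReal.ofReal η) (m : ℕ) (t : ℤ) :
    IsTightMeasureSet (Set.range fun n => (pastLaw (Pn n) (hYn n) m t : Measure (Fin m → ℝ))) := by
  refine isTightMeasureSet_range_of_forall_marginal fun η hη => ?_
  obtain ⟨K, hK, hKn⟩ := htight η hη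
  refine ⟨K, hK, fun n j => ?_⟩
  have hKm : MeasurableSet Kᶜ := hK.measurableSet.compl
  have hmarg : ∀ s, Pn n (Yn n s ⁻¹' Kᶜ)
      = Measure.map (fun ω => fun i : Fin 1 => Yn n (s + (i : ℤ)) ω) (Pn n) {v | v 0 ∈ Kᶜ} :=
    fun s => by
      have h0 : MeasurableSet {v : Fin 1 → ℝ | v 0 ∈ Kᶜ} := measurable_pi_apply (0 : Fin 1) hKm
      rw [Measure.map_apply (measurable_pi_lambda _ fun _ => hYn n _) h0]
      simp [Set.preimage]
  have hj : MeasurableSet {v : Fin m → ℝ | v j ∈ Kᶜ} := measurable_pi_apply j hKm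
  calc Measure.map (pastVec (Yn n) m t) (Pn n) {v | v j ∉ K}
      = Pn n (Yn n (t - 1 - (j : ℤ)) ⁻¹' Kᶜ) :=
        Measure.map_apply (measurable_pastVec (hYn n) m t) hj
    _ = Measure.map (Yn n 1) (Pn n) Kᶜ := by
        rw [hmarg, hstat n 1 _ 1, ← hmarg, Measure.map_apply (hYn n 1) hKm]
    _ ≤ ENNReal.ofReal η := hKn n

/-- Expectations of functions of `(Z₁, …, Z_k)` in terms of the law of a longer past vector. -/
lemma integral_comp_reverse_pastLaw {Ω : Type*} [MeasurableSpace Ω] (Q : Measure Ω)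
    [IsProbabilityMeasure Q] {Z : ℤ → Ω → ℝ} (hZ : ∀ t, Measurable (Z t)) {k m : ℕ} (hkm : k ≤ m)
    {f : (Fin k → ℝ) → ℝ} (hf : Continuous f) :
    ∫ v, f (fun i => v (Fin.rev (Fin.castLE hkm i))) ∂(pastLaw Q hZ m (m + 1) : Measure (Fin m → ℝ))
      = ∫ ω, f (fun i => Z (1 + (i : ℤ)) ω) ∂Q := by
  have hg : Continuous fun v : Fin m → ℝ => f (fun i => v (Fin.rev (Fin.castLE hkm i))) := by
    fun_prop
  simp only [pastLaw, ProbabilityMeasure.coe_mk]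
  rw [integral_map (measurable_pastVec hZ _ _).aemeasurable hg.aestronglyMeasurable]
  congr! with ω i
  simp only [pastVec, Fin.val_rev, Fin.val_castLE]
  congr 1
  omega

/-- **Lemma 4.2**: convergence of transition kernels, equicontinuity of the limit kernel,
tightness and uniqueness of the stationary distribution imply weak convergence of all
finite-dimensional distributions of the stationary Markov processes `Y^{(n)}` to those
of `Y`. -/
theorem markov_fdd_convergence
    (p : ℕ) (hp : 1 ≤ p)
    {Ω : Type*} [MeasurableSpace Ω] (P : Measure Ω) [IsProbabilityMeasure P]
    (Y : ℤ → Ω → ℝ) (hYmeas : ∀ t, Measurable (Y t))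
    {Ωn : ℕ → Type*} [∀ n, MeasurableSpace (Ωn n)] (Pn : ∀ n, Measure (Ωn n))
    [∀ n, IsProbabilityMeasure (Pn n)]
    (Yn : ∀ n, ℤ → Ωn n → ℝ) (hYnmeas : ∀ n t, Measurable (Yn n t))
    -- stationarity of the processes
    (hstat : ∀ (m : ℕ) (t s : ℤ),
      Measure.map (fun ω => fun i : Fin m => Y (t + (i : ℤ)) ω) P
        = Measure.map (fun ω => fun i : Fin m => Y (s + (i : ℤ)) ω) P)
    (hstatn : ∀ n (m : ℕ) (t s : ℤ),
      Measure.map (fun ω => fun i : Fin m => Yn n (t + (i : ℤ)) ω) (Pn n)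
        = Measure.map (fun ω => fun i : Fin m => Yn n (s + (i : ℤ)) ω) (Pn n))
    -- the transition kernels
    (κ : ProbabilityTheory.Kernel (Fin p → ℝ) ℝ) [IsMarkovKernel κ]
    (κn : ℕ → ProbabilityTheory.Kernel (Fin p → ℝ) ℝ) [∀ n, IsMarkovKernel (κn n)]
    (hMarkov : IsMarkovOfOrder P p Y κ)
    (hMarkovn : ∀ n, IsMarkovOfOrder (Pn n) p (Yn n) (κn n))
    -- (i) locally uniform convergence of the kernels
    (hi : ∀ K : Set (Fin p → ℝ), IsCompact K → ∀ δ : ℝ, 0 < δ →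
      ∀ᶠ n in atTop, ∀ y ∈ K, couplingDist ((κn n) y) (κ y) < δ)
    -- (ii) continuity of the limit kernel
    (hii : ∀ y : Fin p → ℝ, ∀ η : ℝ, 0 < η → ∃ δ : ℝ, 0 < δ ∧
      ∀ y' : Fin p → ℝ, dist y' y ≤ δ → couplingDist (κ y) (κ y') < η)
    -- (iii) tightness of the laws of `Y₁^{(n)}`
    (hiii : ∀ η : ℝ, 0 < η → ∃ K : Set ℝ, IsCompact K ∧
      ∀ n, Measure.map (Yn n 1) (Pn n) Kᶜ ≤ ENNReal.ofReal η)
    -- (iv) the law of `(Y₁,…,Y_p)` is the unique stationary distribution for `κ`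
    (hiv_stat : IsStationaryDist p κ
      (Measure.map (fun ω => fun i : Fin p => Y ((p : ℤ) - (i : ℤ)) ω) P))
    (hiv_unique : ∀ μ : Measure (Fin p → ℝ), IsProbabilityMeasure μ →
      IsStationaryDist p κ μ →
      μ = Measure.map (fun ω => fun i : Fin p => Y ((p : ℤ) - (i : ℤ)) ω) P) :
    -- conclusion: weak convergence of all finite-dimensional distributions
    ∀ k : ℕ, ∀ f : BoundedContinuousFunction (Fin k → ℝ) ℝ,
      Tendsto (fun n => ∫ ω, f (fun i => Yn n (1 + (i : ℤ)) ω) ∂(Pn n)) atTop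
        (nhds (∫ ω, f (fun i => Y (1 + (i : ℤ)) ω) ∂P)) := by
  have htight := isTightMeasureSet_range_pastLaw hYnmeas hstatn hiii
  have hbase : ∀ t, Tendsto (fun n => pastLaw (Pn n) (hYnmeas n) p t) atTop
      (𝓝 (pastLaw P hYmeas p t)) := by
    refine fun t => tendsto_of_subseq_tendsto fun ns hns => ?_
    obtain ⟨μ, -, φ, hφ, hμ⟩ := (isCompact_closure_of_isTightMeasureSet
      (S := Set.range fun n => pastLaw (Pn n) (hYnmeas n) p t)
      ((htight p t).subset (by rintro _ ⟨_, ⟨n, rfl⟩, rfl⟩; exact ⟨n, rfl⟩))).tendsto_subseq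
      (x := fun n => pastLaw (Pn (ns n)) (hYnmeas (ns n)) p t)
      fun n => subset_closure ⟨ns n, rfl⟩
    have hnφ : Tendsto (fun n => ns (φ n)) atTop atTop := hns.comp hφ.tendsto_atTop
    have hstep := ((ProbabilityMeasure.continuous_map (continuous_stepMap p)).tendsto _).comp
      (tendsto_compProd_of_couplingDist
        (κs := fun n => κn (ns (φ n))) (μs := fun n => pastLaw _ (hYnmeas (ns (φ n))) p t)
        (fun K hK δ hδ => hnφ.eventually (hi K hK δ hδ)) hii
        ((htight p t).subset (by rintro _ ⟨n, rfl⟩; exact ⟨_, rfl⟩)) hμ)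
    have hlim := tendsto_nhds_unique (hstep.congr fun n => by
      refine Eq.trans (Subtype.ext ?_)
        (pastLaw_eq_of_stationary (hYnmeas (ns (φ n))) (hstatn (ns (φ n))) p (t + 1) t)
      exact map_stepMap_compProd_pastLaw (hYnmeas (ns (φ n))) (hMarkovn (ns (φ n))) t) hμ
    have huniq := hiv_unique μ inferInstance (congrArg Subtype.val hlim)
    have hμeq : μ = pastLaw P hYmeas p t := by
      rw [pastLaw_eq_of_stationary hYmeas hstat p t (p + 1)]
      refine Subtype.ext (huniq.trans ?_)
      change _ = P.map (fun ω (i : Fin p) => Y ((p : ℤ) + 1 - 1 - (i : ℤ)) ω)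
      simp only [add_sub_cancel_right]
    exact ⟨φ, hμeq ▸ hμ⟩
  have hall : ∀ m, p ≤ m → ∀ t, Tendsto (fun n => pastLaw (Pn n) (hYnmeas n) m t) atTop
      (𝓝 (pastLaw P hYmeas m t)) := by
    intro m hm
    induction m, hm using Nat.le_induction with
    | base => exact hbase
    | succ m hm ih =>
      intro t
      obtain ⟨t, rfl⟩ : ∃ s, t = s + 1 := ⟨t - 1, by ring⟩
      let r : (Fin m → ℝ) → (Fin p → ℝ) := fun v i => v (Fin.castLE hm i)
      have hr : Continuous r := by fun_prop
      have hstep := ((ProbabilityMeasure.continuous_map (continuous_finCons_swap m)).tendsto _).comp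
        (tendsto_compProd_of_couplingDist (κ := κ.comap r hr.measurable)
          (κs := fun n => (κn n).comap r hr.measurable)
          (fun K hK δ hδ => (hi _ (hK.image hr) δ hδ).mono fun n hn y hy =>
            hn _ (Set.mem_image_of_mem r hy))
          (fun y η hη => by
            obtain ⟨δ, hδ, h⟩ := hii (r y) η hη
            refine ⟨δ, hδ, fun y' hy' => h (r y') ?_⟩
            exact ((dist_pi_le_iff dist_nonneg).2 fun i => dist_le_pi_dist y' y _).trans hy')
          (htight m t) (ih t))
      convert hstep using 1
      · funext n
        exact Subtype.ext
          (pastLaw_succ (hYnmeas n) (hMarkovn n) hm hr.measurable (fun _ _ => rfl) t)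
      · congr 1
        exact Subtype.ext (pastLaw_succ hYmeas hMarkov hm hr.measurable (fun _ _ => rfl) t)
  intro k f
  have hrev : Continuous fun (v : Fin (k + p) → ℝ) (i : Fin k) =>
      v (Fin.rev (Fin.castLE (Nat.le_add_right k p) i)) := by fun_prop
  have hlim := ProbabilityMeasure.tendsto_iff_forall_integral_tendsto.1
    (hall (k + p) (Nat.le_add_left p k) ((k + p : ℕ) + 1)) (f.compContinuous ⟨_, hrev⟩)
  convert hlim using 1
  · funext n
    exact (integral_comp_reverse_pastLaw (Pn n) (hYnmeas n) (Nat.le_add_right k p)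
      f.continuous).symm
  · congr 1
    exact (integral_comp_reverse_pastLaw P hYmeas (Nat.le_add_right k p) f.continuous).symm
end

section
/- Let n ≥ 1 and let (Z_t)_{t=1,…,n} be real random variables with |Z_t| ≤ 1 almost surely, E Z_t = 0, which are stationary in the sense that the joint law of (Z_t,…,Z_{t+m}) does not depend on t for indices in {1,…,n}. For r ∈ {0,…,n−1} and q ∈ {2,4}, define C_{r,q} = max_{1≤m≤q−1} sup{ |cov(Z_{t₁} ⋯ Z_{t_m}, Z_{t_{m+1}} ⋯ Z_{t_q})| : 1 ≤ t₁ ≤ ⋯ ≤ t_q ≤ n and max_{1≤j≤q−1}(t_{j+1} − t_j) = t_{m+1} − t_m = r } (the supremum over the empty set being 0). Then E[((Z₁ + ⋯ + Z_n)/√n)⁴] ≤ 24 · ( (Σ_{r=0}^{n−1} C_{r,2})² + (3/n) Σ_{r=0}^{n−1} (r+1)² C_{r,4} ). -/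
open MeasureTheory Filter

/-- Covariance of two real random variables. -/
noncomputable def rcov {Ω : Type*} [MeasurableSpace Ω] (P : Measure Ω) (U V : Ω → ℝ) : ℝ :=
  (∫ ω, U ω * V ω ∂P) - (∫ ω, U ω ∂P) * (∫ ω, V ω ∂P)

/-- The weak-dependence coefficient
`C_{r,q} = max_{1≤m≤q−1} sup { |cov(Z_{t₁}⋯Z_{t_m}, Z_{t_{m+1}}⋯Z_{t_q})| :
  1 ≤ t₁ ≤ ⋯ ≤ t_q ≤ n, max_j (t_{j+1} − t_j) = t_{m+1} − t_m = r }`,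
the supremum over the empty set being `0` (which is `Real.sSup ∅` in Lean). -/
noncomputable def Ccoef {Ω : Type*} [MeasurableSpace Ω] (P : Measure Ω)
    (Z : ℕ → Ω → ℝ) (n r q : ℕ) : ℝ :=
  sSup ({0} ∪ {c : ℝ | ∃ (m : ℕ), 1 ≤ m ∧ m ≤ q - 1 ∧
    ∃ t : Fin q → ℕ, Monotone t ∧ (∀ j, 1 ≤ t j ∧ t j ≤ n) ∧
      (∀ (j : ℕ) (hj : j + 1 < q), t ⟨j + 1, hj⟩ - t ⟨j, by omega⟩ ≤ r) ∧
      (∃ hm : m < q, t ⟨m, hm⟩ - t ⟨m - 1, by omega⟩ = r) ∧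
      c = |rcov P (fun ω => ∏ j ∈ Finset.univ.filter (fun j : Fin q => (j : ℕ) < m), Z (t j) ω)
             (fun ω => ∏ j ∈ Finset.univ.filter (fun j : Fin q => m ≤ (j : ℕ)), Z (t j) ω)|})

section Coefficients

variable {Ω : Type*} [MeasurableSpace Ω] {P : Measure Ω} {Z : ℕ → Ω → ℝ} {n : ℕ}

lemma ae_abs_prod_le_one (hbdd : ∀ t, 1 ≤ t → t ≤ n → ∀ᵐ ω ∂P, |Z t ω| ≤ 1)
    {q : ℕ} {t : Fin q → ℕ} (ht : ∀ j, 1 ≤ t j ∧ t j ≤ n) (s : Finset (Fin q)) :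
    ∀ᵐ ω ∂P, |∏ j ∈ s, Z (t j) ω| ≤ 1 := by
  have h : ∀ᵐ ω ∂P, ∀ j, |Z (t j) ω| ≤ 1 :=
    ae_all_iff.2 fun j => hbdd _ (ht j).1 (ht j).2
  filter_upwards [h] with ω hω
  rw [Finset.abs_prod]
  exact Finset.prod_le_one (fun _ _ => abs_nonneg _) fun j _ => hω j

lemma abs_integral_le_one_of_ae_abs_le_one [IsProbabilityMeasure P] {f : Ω → ℝ}
    (hf : ∀ᵐ ω ∂P, |f ω| ≤ 1) : |∫ ω, f ω ∂P| ≤ 1 := by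
  simpa using norm_integral_le_of_norm_le_const (μ := P) (C := 1) (f := f) hf

lemma abs_rcov_le_two [IsProbabilityMeasure P] {U V : Ω → ℝ}
    (hU : ∀ᵐ ω ∂P, |U ω| ≤ 1) (hV : ∀ᵐ ω ∂P, |V ω| ≤ 1) : |rcov P U V| ≤ 2 := by
  have hUV : ∀ᵐ ω ∂P, |U ω * V ω| ≤ 1 := by
    filter_upwards [hU, hV] with ω h₁ h₂
    rw [abs_mul]
    exact mul_le_one₀ h₁ (abs_nonneg _) h₂
  have h₁ := abs_integral_le_one_of_ae_abs_le_one hUV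
  have h₂ : |(∫ ω, U ω ∂P) * ∫ ω, V ω ∂P| ≤ 1 := by
    rw [abs_mul]
    exact mul_le_one₀ (abs_integral_le_one_of_ae_abs_le_one hU) (abs_nonneg _)
      (abs_integral_le_one_of_ae_abs_le_one hV)
  unfold rcov
  exact (abs_sub _ _).trans (by linarith)

lemma bddAbove_Ccoef_set [IsProbabilityMeasure P]
    (hbdd : ∀ t, 1 ≤ t → t ≤ n → ∀ᵐ ω ∂P, |Z t ω| ≤ 1) (r q : ℕ) :
    BddAbove ({0} ∪ {c : ℝ | ∃ (m : ℕ), 1 ≤ m ∧ m ≤ q - 1 ∧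
      ∃ t : Fin q → ℕ, Monotone t ∧ (∀ j, 1 ≤ t j ∧ t j ≤ n) ∧
        (∀ (j : ℕ) (hj : j + 1 < q), t ⟨j + 1, hj⟩ - t ⟨j, by omega⟩ ≤ r) ∧
        (∃ hm : m < q, t ⟨m, hm⟩ - t ⟨m - 1, by omega⟩ = r) ∧
        c = |rcov P (fun ω => ∏ j ∈ Finset.univ.filter (fun j : Fin q => (j : ℕ) < m), Z (t j) ω)
          (fun ω => ∏ j ∈ Finset.univ.filter (fun j : Fin q => m ≤ (j : ℕ)), Z (t j) ω)|}) := by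
  refine ⟨2, ?_⟩
  rintro c (hc | ⟨m, -, -, t, -, ht, -, -, rfl⟩)
  · rw [Set.mem_singleton_iff.1 hc]
    norm_num
  · exact abs_rcov_le_two (ae_abs_prod_le_one hbdd ht _) (ae_abs_prod_le_one hbdd ht _)

lemma Ccoef_nonneg [IsProbabilityMeasure P]
    (hbdd : ∀ t, 1 ≤ t → t ≤ n → ∀ᵐ ω ∂P, |Z t ω| ≤ 1) (r q : ℕ) : 0 ≤ Ccoef P Z n r q :=
  le_csSup (bddAbove_Ccoef_set hbdd r q) (Or.inl rfl)

/-- Splitting a product moment at its largest gap. -/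
lemma abs_integral_prod_le [IsProbabilityMeasure P]
    (hbdd : ∀ t, 1 ≤ t → t ≤ n → ∀ᵐ ω ∂P, |Z t ω| ≤ 1) {q m : ℕ} (hm : 1 ≤ m) (hmq : m < q)
    {t : Fin q → ℕ} (hmono : Monotone t) (ht : ∀ j, 1 ≤ t j ∧ t j ≤ n)
    (hgap : ∀ (j : ℕ) (hj : j + 1 < q),
      t ⟨j + 1, hj⟩ - t ⟨j, by omega⟩ ≤ t ⟨m, hmq⟩ - t ⟨m - 1, by omega⟩) :
    |∫ ω, ∏ j, Z (t j) ω ∂P| ≤ Ccoef P Z n (t ⟨m, hmq⟩ - t ⟨m - 1, by omega⟩) q +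
      |∫ ω, ∏ j ∈ Finset.univ.filter (fun j : Fin q => (j : ℕ) < m), Z (t j) ω ∂P| *
      |∫ ω, ∏ j ∈ Finset.univ.filter (fun j : Fin q => m ≤ (j : ℕ)), Z (t j) ω ∂P| := by
  have hcov : |rcov P
      (fun ω => ∏ j ∈ Finset.univ.filter (fun j : Fin q => (j : ℕ) < m), Z (t j) ω)
      (fun ω => ∏ j ∈ Finset.univ.filter (fun j : Fin q => m ≤ (j : ℕ)), Z (t j) ω)| ≤
      Ccoef P Z n (t ⟨m, hmq⟩ - t ⟨m - 1, by omega⟩) q := le_csSup (bddAbove_Ccoef_set hbdd _ q)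
    (Or.inr ⟨m, hm, by omega, t, hmono, ht, hgap, ⟨hmq, rfl⟩, rfl⟩)
  have hprod : ∀ ω, (∏ j ∈ Finset.univ.filter (fun j : Fin q => (j : ℕ) < m), Z (t j) ω) *
      (∏ j ∈ Finset.univ.filter (fun j : Fin q => m ≤ (j : ℕ)), Z (t j) ω) =
      ∏ j, Z (t j) ω := fun ω => by
    simpa only [not_lt] using Finset.prod_filter_mul_prod_filter_not Finset.univ
      (fun j : Fin q => (j : ℕ) < m) (fun j => Z (t j) ω)
  simp only [rcov, hprod] at hcov
  rw [← abs_mul]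
  have := abs_sub_abs_le_abs_sub (∫ ω, ∏ j, Z (t j) ω ∂P)
    ((∫ ω, ∏ j ∈ Finset.univ.filter (fun j : Fin q => (j : ℕ) < m), Z (t j) ω ∂P) *
      ∫ ω, ∏ j ∈ Finset.univ.filter (fun j : Fin q => m ≤ (j : ℕ)), Z (t j) ω ∂P)
  linarith

lemma abs_integral_mul_le_Ccoef [IsProbabilityMeasure P]
    (hbdd : ∀ t, 1 ≤ t → t ≤ n → ∀ᵐ ω ∂P, |Z t ω| ≤ 1)
    (hmean : ∀ t, 1 ≤ t → t ≤ n → ∫ ω, Z t ω ∂P = 0)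
    {s u : ℕ} (hs : 1 ≤ s) (hsu : s ≤ u) (hu : u ≤ n) :
    |∫ ω, Z s ω * Z u ω ∂P| ≤ Ccoef P Z n (u - s) 2 := by
  have h := abs_integral_prod_le (P := P) hbdd (q := 2) (m := 1) le_rfl one_lt_two (t := ![s, u])
    (by intro i j hij; fin_cases i <;> fin_cases j <;> simp_all)
    (by intro j; fin_cases j <;> simp <;> omega)
    (by intro j hj; obtain rfl : j = 0 := by omega
        exact le_rfl)
  simpa [Finset.prod_filter, Fin.prod_univ_two, hmean s hs (hsu.trans hu)] using h

/-- The bound for sorted quadruples: either an outer gap is the largest one, and centering removes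
the product of means, or the middle gap is, and that product is a product of covariances. -/
lemma abs_integral_prod_four_le [IsProbabilityMeasure P]
    (hbdd : ∀ t, 1 ≤ t → t ≤ n → ∀ᵐ ω ∂P, |Z t ω| ≤ 1)
    (hmean : ∀ t, 1 ≤ t → t ≤ n → ∫ ω, Z t ω ∂P = 0)
    {t : Fin 4 → ℕ} (hmono : Monotone t) (ht : ∀ j, 1 ≤ t j ∧ t j ≤ n) :
    |∫ ω, ∏ j, Z (t j) ω ∂P| ≤
      Ccoef P Z n (t 1 - t 0) 2 * Ccoef P Z n (t 3 - t 2) 2 +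
      ((if t 2 - t 1 ≤ t 1 - t 0 ∧ t 3 - t 2 ≤ t 1 - t 0 then Ccoef P Z n (t 1 - t 0) 4 else 0) +
      (if t 1 - t 0 ≤ t 2 - t 1 ∧ t 3 - t 2 ≤ t 2 - t 1 then Ccoef P Z n (t 2 - t 1) 4 else 0) +
      (if t 1 - t 0 ≤ t 3 - t 2 ∧ t 2 - t 1 ≤ t 3 - t 2 then Ccoef P Z n (t 3 - t 2) 4 else 0)) := by
  have h01 : t 0 ≤ t 1 := hmono (by decide)
  have h23 : t 2 ≤ t 3 := hmono (by decide)
  have hC := fun r q => Ccoef_nonneg (P := P) hbdd r q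
  have hite : ∀ (p : Prop) [Decidable p] (r : ℕ), 0 ≤ if p then Ccoef P Z n r 4 else 0 :=
    fun p _ r => by split_ifs; exacts [hC _ _, le_rfl]
  have hprod := mul_nonneg (hC (t 1 - t 0) 2) (hC (t 3 - t 2) 2)
  have i₁ := hite (t 2 - t 1 ≤ t 1 - t 0 ∧ t 3 - t 2 ≤ t 1 - t 0) (t 1 - t 0)
  have i₂ := hite (t 1 - t 0 ≤ t 2 - t 1 ∧ t 3 - t 2 ≤ t 2 - t 1) (t 2 - t 1)
  have i₃ := hite (t 1 - t 0 ≤ t 3 - t 2 ∧ t 2 - t 1 ≤ t 3 - t 2) (t 3 - t 2)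
  have split (m : ℕ) (hm : 1 ≤ m) (hmq : m < 4) (h : ∀ (j : ℕ) (hj : j + 1 < 4),
      t ⟨j + 1, hj⟩ - t ⟨j, by omega⟩ ≤ t ⟨m, hmq⟩ - t ⟨m - 1, by omega⟩) :=
    abs_integral_prod_le (P := P) hbdd hm hmq hmono ht h
  by_cases ha : t 2 - t 1 ≤ t 1 - t 0 ∧ t 3 - t 2 ≤ t 1 - t 0
  · have h := split 1 le_rfl (by norm_num) (by
      intro j hj
      have : j < 3 := by omega
      interval_cases j
      exacts [le_rfl, ha.1, ha.2])
    simp [Finset.prod_filter, Fin.prod_univ_four, hmean _ (ht 0).1 (ht 0).2] at h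
    rw [if_pos ha] at i₁ ⊢
    simp only [Fin.prod_univ_four]
    linarith
  by_cases hc : t 1 - t 0 ≤ t 3 - t 2 ∧ t 2 - t 1 ≤ t 3 - t 2
  · have h := split 3 (by norm_num) (by norm_num) (by
      intro j hj
      have : j < 3 := by omega
      interval_cases j
      exacts [hc.1, hc.2, le_rfl])
    simp [Finset.prod_filter, Fin.prod_univ_four, hmean _ (ht 3).1 (ht 3).2] at h
    rw [if_pos hc] at i₃ ⊢
    simp only [Fin.prod_univ_four]
    linarith
  have hb : t 1 - t 0 ≤ t 2 - t 1 ∧ t 3 - t 2 ≤ t 2 - t 1 := by omega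
  have h := split 2 (by norm_num) (by norm_num) (by
    intro j hj
    have : j < 3 := by omega
    interval_cases j
    exacts [hb.1, le_rfl, hb.2])
  simp [Finset.prod_filter, Fin.prod_univ_four] at h
  have hmul := mul_le_mul (abs_integral_mul_le_Ccoef (P := P) hbdd hmean (ht 0).1 h01 (ht 1).2)
    (abs_integral_mul_le_Ccoef (P := P) hbdd hmean (ht 2).1 h23 (ht 3).2) (abs_nonneg _) (hC _ _)
  rw [if_pos hb] at i₂ ⊢
  simp only [Fin.prod_univ_four]
  linarith

end Coefficients

section Counting

/-- A sum of nonnegative symmetric terms is at most `q!` times its sorted part. -/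
lemma sum_piFinset_le_factorial_mul_sum_monotone {q : ℕ} (s : Finset ℕ) (g : (Fin q → ℕ) → ℝ)
    (hg : ∀ t, 0 ≤ g t) (hsymm : ∀ t (σ : Equiv.Perm (Fin q)), g (t ∘ σ) = g t) :
    ∑ t ∈ Fintype.piFinset (fun _ : Fin q => s), g t ≤
      (q.factorial : ℝ) *
        ∑ t ∈ (Fintype.piFinset (fun _ : Fin q => s)).filter (fun t => Monotone t), g t := by
  calc ∑ t ∈ Fintype.piFinset (fun _ : Fin q => s), g t
      ≤ ∑ t ∈ Fintype.piFinset (fun _ : Fin q => s),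
          ∑ σ : Equiv.Perm (Fin q), if Monotone (t ∘ σ) then g (t ∘ σ) else 0 := by
        refine Finset.sum_le_sum fun t _ => ?_
        have h := Finset.single_le_sum
          (f := fun σ : Equiv.Perm (Fin q) => if Monotone (t ∘ σ) then g (t ∘ σ) else 0)
          (fun σ _ => by split_ifs; exacts [hg _, le_rfl])
          (Finset.mem_univ (Tuple.sort t))
        simpa [Tuple.monotone_sort t, hsymm] using h
    _ = ∑ _σ : Equiv.Perm (Fin q),
          ∑ t ∈ Fintype.piFinset (fun _ : Fin q => s), if Monotone t then g t else 0 := by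
        rw [Finset.sum_comm]
        refine Finset.sum_congr rfl fun σ _ => ?_
        refine Finset.sum_bij' (fun t _ => t ∘ σ) (fun t _ => t ∘ σ.symm) ?_ ?_ ?_ ?_ ?_
        · intro t ht
          simp only [Fintype.mem_piFinset] at ht ⊢
          exact fun j => ht _
        · intro t ht
          simp only [Fintype.mem_piFinset] at ht ⊢
          exact fun j => ht _
        · intro t _
          ext j
          simp
        · intro t _
          ext j
          simp
        · intro t _
          rfl
    _ = _ := by
        simp [Finset.sum_filter, Fintype.card_perm]

/-- Summing a nonnegative function of an injective image over-counts at most the target. -/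
lemma sum_comp_le_sum_of_injOn {α β : Type*} [DecidableEq β] {s : Finset α} {u : Finset β}
    (φ : α → β) (F : β → ℝ) (hφ : ∀ a ∈ s, φ a ∈ u) (hinj : Set.InjOn φ s)
    (hF : ∀ b ∈ u, 0 ≤ F b) : ∑ a ∈ s, F (φ a) ≤ ∑ b ∈ u, F b := by
  rw [← Finset.sum_image hinj]
  exact Finset.sum_le_sum_of_subset_of_nonneg (Finset.image_subset_iff.2 hφ) fun b hb _ => hF b hb

lemma sum_ite_le_and_le_eq (n : ℕ) (c : ℕ → ℝ) :
    ∑ a ∈ Finset.range n, ∑ b ∈ Finset.range n, ∑ d ∈ Finset.range n,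
      (if b ≤ a ∧ d ≤ a then c a else 0) = ∑ r ∈ Finset.range n, ((r : ℝ) + 1) ^ 2 * c r := by
  refine Finset.sum_congr rfl fun a ha => ?_
  have ha' := Finset.mem_range.1 ha
  have hf : (Finset.range n).filter (fun b => b ≤ a) = Finset.range (a + 1) := by
    ext b
    simp only [Finset.mem_filter, Finset.mem_range]
    omega
  simp only [ite_and, Finset.sum_ite_irrel, Finset.sum_const_zero]
  simp only [← Finset.sum_filter, hf, Finset.sum_const, Finset.card_range, nsmul_eq_mul]
  push_cast
  ring

lemma sum_monotone_gaps_mul_le (n : ℕ) {c : ℕ → ℝ} (hc : ∀ r, 0 ≤ c r) :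
    ∑ t ∈ (Fintype.piFinset (fun _ : Fin 4 => Finset.Icc 1 n)).filter (fun t => Monotone t),
      c (t 1 - t 0) * c (t 3 - t 2) ≤ (n : ℝ) ^ 2 * (∑ r ∈ Finset.range n, c r) ^ 2 := by
  refine (sum_comp_le_sum_of_injOn
    (u := (Finset.Icc 1 n ×ˢ Finset.Icc 1 n) ×ˢ (Finset.range n ×ˢ Finset.range n))
    (fun t : Fin 4 → ℕ => ((t 0, t 2), (t 1 - t 0, t 3 - t 2)))
    (fun p => c p.2.1 * c p.2.2) ?_ ?_ fun p _ => mul_nonneg (hc _) (hc _)).trans_eq ?_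
  · intro t ht
    simp only [Finset.mem_filter, Fintype.mem_piFinset, Finset.mem_Icc] at ht
    have h0 := ht.1 0
    have h1 := ht.1 1
    have h2 := ht.1 2
    have h3 := ht.1 3
    simp only [Finset.mem_product, Finset.mem_Icc, Finset.mem_range]
    omega
  · intro t ht u hu h
    simp only [Finset.coe_filter, Set.mem_ofPred_eq] at ht hu
    have t01 : t 0 ≤ t 1 := ht.2 (by decide)
    have t23 : t 2 ≤ t 3 := ht.2 (by decide)
    have u01 : u 0 ≤ u 1 := hu.2 (by decide)
    have u23 : u 2 ≤ u 3 := hu.2 (by decide)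
    simp only [Prod.mk.injEq] at h
    ext j
    fin_cases j <;> simp <;> omega
  · simp only [Finset.sum_product, Finset.sum_const, nsmul_eq_mul,
      ← Finset.mul_sum, ← Finset.sum_mul]
    simp
    ring

lemma sum_monotone_max_gap_le (n : ℕ) {c : ℕ → ℝ} (hc : ∀ r, 0 ≤ c r) :
    ∑ t ∈ (Fintype.piFinset (fun _ : Fin 4 => Finset.Icc 1 n)).filter (fun t => Monotone t),
      ((if t 2 - t 1 ≤ t 1 - t 0 ∧ t 3 - t 2 ≤ t 1 - t 0 then c (t 1 - t 0) else 0) +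
      (if t 1 - t 0 ≤ t 2 - t 1 ∧ t 3 - t 2 ≤ t 2 - t 1 then c (t 2 - t 1) else 0) +
      (if t 1 - t 0 ≤ t 3 - t 2 ∧ t 2 - t 1 ≤ t 3 - t 2 then c (t 3 - t 2) else 0)) ≤
      3 * n * ∑ r ∈ Finset.range n, ((r : ℝ) + 1) ^ 2 * c r := by
  have hite : ∀ (p : Prop) [Decidable p] (r : ℕ), 0 ≤ if p then c r else 0 :=
    fun p _ r => by split_ifs; exacts [hc _, le_rfl]
  refine (sum_comp_le_sum_of_injOn
    (u := Finset.Icc 1 n ×ˢ (Finset.range n ×ˢ (Finset.range n ×ˢ Finset.range n)))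
    (fun t : Fin 4 → ℕ => (t 0, (t 1 - t 0, (t 2 - t 1, t 3 - t 2))))
    (fun p => (if p.2.2.1 ≤ p.2.1 ∧ p.2.2.2 ≤ p.2.1 then c p.2.1 else 0) +
      (if p.2.1 ≤ p.2.2.1 ∧ p.2.2.2 ≤ p.2.2.1 then c p.2.2.1 else 0) +
      (if p.2.1 ≤ p.2.2.2 ∧ p.2.2.1 ≤ p.2.2.2 then c p.2.2.2 else 0)) ?_ ?_
    fun p _ => add_nonneg (add_nonneg (hite _ _) (hite _ _)) (hite _ _)).trans_eq ?_
  · intro t ht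
    simp only [Finset.mem_filter, Fintype.mem_piFinset, Finset.mem_Icc] at ht
    have h0 := ht.1 0
    have h1 := ht.1 1
    have h2 := ht.1 2
    have h3 := ht.1 3
    simp only [Finset.mem_product, Finset.mem_Icc, Finset.mem_range]
    omega
  · intro t ht u hu h
    simp only [Finset.coe_filter, Set.mem_ofPred_eq] at ht hu
    have t01 : t 0 ≤ t 1 := ht.2 (by decide)
    have t12 : t 1 ≤ t 2 := ht.2 (by decide)
    have t23 : t 2 ≤ t 3 := ht.2 (by decide)
    have u01 : u 0 ≤ u 1 := hu.2 (by decide)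
    have u12 : u 1 ≤ u 2 := hu.2 (by decide)
    have u23 : u 2 ≤ u 3 := hu.2 (by decide)
    simp only [Prod.mk.injEq] at h
    ext j
    fin_cases j <;> simp <;> omega
  · have hfirst := sum_ite_le_and_le_eq n c
    have hmiddle : ∑ a ∈ Finset.range n, ∑ b ∈ Finset.range n, ∑ d ∈ Finset.range n,
        (if a ≤ b ∧ d ≤ b then c b else 0) =
        ∑ r ∈ Finset.range n, ((r : ℝ) + 1) ^ 2 * c r := by
      rw [Finset.sum_comm]
      exact hfirst
    have hlast : ∑ a ∈ Finset.range n, ∑ b ∈ Finset.range n, ∑ d ∈ Finset.range n,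
        (if a ≤ d ∧ b ≤ d then c d else 0) =
        ∑ r ∈ Finset.range n, ((r : ℝ) + 1) ^ 2 * c r := by
      rw [Finset.sum_congr rfl fun a _ => Finset.sum_comm, Finset.sum_comm]
      exact hfirst
    simp only [Finset.sum_product, Finset.sum_add_distrib, hfirst, hmiddle, hlast,
      Finset.sum_const, Nat.card_Icc, nsmul_eq_mul]
    simp
    ring

end Counting

section Moments

variable {Ω : Type*} [MeasurableSpace Ω] {P : Measure Ω} [IsProbabilityMeasure P]
  {Z : ℕ → Ω → ℝ} {n : ℕ}

lemma integral_sum_pow_eq (hmeas : ∀ t, Measurable (Z t))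
    (hbdd : ∀ t, 1 ≤ t → t ≤ n → ∀ᵐ ω ∂P, |Z t ω| ≤ 1) (q : ℕ) :
    ∫ ω, (∑ t ∈ Finset.Icc 1 n, Z t ω) ^ q ∂P =
      ∑ t ∈ Fintype.piFinset (fun _ : Fin q => Finset.Icc 1 n), ∫ ω, ∏ j, Z (t j) ω ∂P := by
  simp_rw [Finset.sum_pow']
  refine integral_finsetSum _ fun t ht => ?_
  simp only [Fintype.mem_piFinset, Finset.mem_Icc] at ht
  exact Integrable.of_bound
    (Finset.measurable_fun_prod _ fun j _ => hmeas (t j)).aestronglyMeasurable 1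
    (ae_abs_prod_le_one hbdd ht _)

lemma integral_sum_pow_four_le (hmeas : ∀ t, Measurable (Z t))
    (hbdd : ∀ t, 1 ≤ t → t ≤ n → ∀ᵐ ω ∂P, |Z t ω| ≤ 1)
    (hmean : ∀ t, 1 ≤ t → t ≤ n → ∫ ω, Z t ω ∂P = 0) :
    ∫ ω, (∑ t ∈ Finset.Icc 1 n, Z t ω) ^ 4 ∂P ≤
      24 * ((n : ℝ) ^ 2 * (∑ r ∈ Finset.range n, Ccoef P Z n r 2) ^ 2 +
        3 * n * ∑ r ∈ Finset.range n, ((r : ℝ) + 1) ^ 2 * Ccoef P Z n r 4) := by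
  rw [integral_sum_pow_eq hmeas hbdd]
  refine (Finset.sum_le_sum fun t _ => le_abs_self (∫ ω, ∏ j, Z (t j) ω ∂P)).trans ?_
  refine (sum_piFinset_le_factorial_mul_sum_monotone (Finset.Icc 1 n)
    (fun t : Fin 4 → ℕ => |∫ ω, ∏ j, Z (t j) ω ∂P|) (fun _ => abs_nonneg _) ?_).trans ?_
  · intro t σ
    have h : ∀ ω, ∏ j, Z ((t ∘ σ) j) ω = ∏ j, Z (t j) ω :=
      fun ω => Equiv.prod_comp σ fun j => Z (t j) ω
    simp only [h]
  · have h24 : ((Nat.factorial 4 : ℕ) : ℝ) = 24 := by norm_num [Nat.factorial]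
    rw [h24]
    refine mul_le_mul_of_nonneg_left ?_ (by norm_num)
    refine (Finset.sum_le_sum fun t ht => abs_integral_prod_four_le hbdd hmean
      (Finset.mem_filter.1 ht).2 ?_).trans ?_
    · simpa [Fintype.mem_piFinset] using (Finset.mem_filter.1 ht).1
    · rw [Finset.sum_add_distrib]
      exact add_le_add
        (sum_monotone_gaps_mul_le n fun r => Ccoef_nonneg hbdd r 2)
        (sum_monotone_max_gap_le n fun r => Ccoef_nonneg hbdd r 4)

end Moments

/-- The fourth-moment inequality (7.16): for a stationary sequence `Z₁,…,Z_n` of centered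
random variables bounded by `1`,
`E[((Z₁+⋯+Z_n)/√n)⁴] ≤ 24 ((∑_{r<n} C_{r,2})² + (3/n) ∑_{r<n} (r+1)² C_{r,4})`. -/
theorem fourth_moment_weak_dependence
    {Ω : Type*} [MeasurableSpace Ω] (P : Measure Ω) [IsProbabilityMeasure P]
    (n : ℕ) (hn : 1 ≤ n) (Z : ℕ → Ω → ℝ)
    (hmeas : ∀ t, Measurable (Z t))
    (hbdd : ∀ t, 1 ≤ t → t ≤ n → ∀ᵐ ω ∂P, |Z t ω| ≤ 1)
    (hmean : ∀ t, 1 ≤ t → t ≤ n → ∫ ω, Z t ω ∂P = 0)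
    (hstat : ∀ (m : ℕ) (t t' : ℕ), 1 ≤ t → t + m ≤ n → 1 ≤ t' → t' + m ≤ n →
      Measure.map (fun ω => fun j : Fin (m + 1) => Z (t + j) ω) P
        = Measure.map (fun ω => fun j : Fin (m + 1) => Z (t' + j) ω) P) :
    ∫ ω, ((∑ t ∈ Finset.Icc 1 n, Z t ω) / Real.sqrt n) ^ 4 ∂P
      ≤ 24 * ((∑ r ∈ Finset.range n, Ccoef P Z n r 2) ^ 2
          + 3 / n * ∑ r ∈ Finset.range n, ((r : ℝ) + 1) ^ 2 * Ccoef P Z n r 4) := by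
  have hn0 : (0 : ℝ) < n := by exact_mod_cast hn
  have hsqrt : Real.sqrt n ^ 4 = (n : ℝ) ^ 2 := by
    rw [show 4 = 2 * 2 from rfl, pow_mul, Real.sq_sqrt hn0.le]
  simp only [div_pow, hsqrt, integral_div]
  rw [div_le_iff₀ (by positivity)]
  refine (integral_sum_pow_four_le hmeas hbdd hmean).trans_eq ?_
  field_simp
end

section
/- Let p ≥ 1 and n ≥ 1, let x_{1−p},…,x_n be real numbers, θ̂ ∈ ℝ^p, and let F̃: ℝ → ℝ be nondecreasing, bounded and right-continuous. For (x, y) ∈ ℝ^p × ℝ put U_n(x, y) = (1/√n) Σ_{t=1}^n 1{𝕩_{t−1} ⪯ x} · [ 1{x_t ≤ y} − F̃(y − θ̂'𝕩_{t−1}) ], where 𝕩_{t−1} = (x_{t−1},…,x_{t−p})' and ⪯ denotes componentwise ≤. Then sup_{(x,y) ∈ ℝ^p × ℝ} |U_n(x, y)| equals the maximum of the following finite collection of values: 0, together with |U_n(x, x_t)|, |lim_{y↑x_t} U_n(x, y)| for t = 1,…,n, |lim_{y→+∞} U_n(x, y)| and |lim_{y→−∞} U_n(x, y)|, where x ranges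 over the finite grid {x₀, x₁,…,x_{n−1}} × {x_{−1}, x₀,…,x_{n−2}} × ⋯ × {x_{1−p}, x_{2−p},…,x_{n−p}}. -/
open Filter Topology

/-- The (deterministic) deviation process
`U_n(v, y) = (1/√n) ∑_{t=1}^n 1{𝕩_{t−1} ⪯ v} [1{x_t ≤ y} − F̃(y − θ̂'𝕩_{t−1})]`,
where `𝕩_{t−1} = (x_{t−1},…,x_{t−p})`. -/
noncomputable def Udet (p : ℕ) (n : ℕ) (x : ℤ → ℝ) (θ : Fin p → ℝ) (F : ℝ → ℝ)
    (v : Fin p → ℝ) (y : ℝ) : ℝ :=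
  (1 / Real.sqrt n) * ∑ t ∈ Finset.Icc (1 : ℤ) (n : ℤ),
    (if ∀ i : Fin p, x (t - 1 - (i : ℤ)) ≤ v i then (1 : ℝ) else 0)
      * ((if x t ≤ y then (1 : ℝ) else 0) - F (y - ∑ i : Fin p, θ i * x (t - 1 - (i : ℤ))))

/-- A filter on `ℝ` along which every bounded nondecreasing function converges. -/
def HasMonotoneLimits (l : Filter ℝ) : Prop :=
  ∀ h : ℝ → ℝ, Monotone h → (∃ M : ℝ, ∀ y, |h y| ≤ M) → ∃ L, Tendsto h l (𝓝 L)

lemma hasMonotoneLimits_nhdsLT (a : ℝ) : HasMonotoneLimits (𝓝[<] a) :=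
  fun _ hm _ => ⟨_, hm.tendsto_nhdsLT a⟩

lemma hasMonotoneLimits_atTop : HasMonotoneLimits atTop := by
  rintro h hm ⟨M, hM⟩
  refine ⟨_, tendsto_atTop_ciSup hm ⟨M, ?_⟩⟩
  rintro _ ⟨y, rfl⟩
  exact (abs_le.1 (hM y)).2

lemma hasMonotoneLimits_atBot : HasMonotoneLimits atBot := by
  rintro h hm ⟨M, hM⟩
  refine ⟨_, tendsto_atBot_ciInf hm ⟨-M, ?_⟩⟩
  rintro _ ⟨y, rfl⟩
  exact (abs_le.1 (hM y)).1

section Udet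

variable {p n : ℕ} {x : ℤ → ℝ} {θ : Fin p → ℝ} {F : ℝ → ℝ}

lemma tendsto_Udet_limUnder (hF : Monotone F) (hFb : ∃ M : ℝ, ∀ y, |F y| ≤ M)
    {l : Filter ℝ} (hl : HasMonotoneLimits l) (v : Fin p → ℝ) :
    Tendsto (fun y => Udet p n x θ F v y) l
      (𝓝 (limUnder l (fun y => Udet p n x θ F v y))) := by
  have hind : ∀ t : ℤ, ∃ L, Tendsto (fun y : ℝ => if x t ≤ y then (1 : ℝ) else 0) l (𝓝 L) := by
    intro t
    refine hl _ ?_ ⟨1, fun y => ?_⟩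
    · intro y z hyz
      dsimp only
      split_ifs with h1 h2
      · exact le_rfl
      · exact absurd (h1.trans hyz) h2
      · exact zero_le_one
      · exact le_rfl
    · split_ifs <;> simp
  have hshift : ∀ c : ℝ, ∃ L, Tendsto (fun y : ℝ => F (y - c)) l (𝓝 L) := by
    intro c
    obtain ⟨M, hM⟩ := hFb
    exact hl _ (fun y z hyz => hF (by linarith)) ⟨M, fun y => hM _⟩
  choose L hL using hind
  choose K hK using hshift
  apply tendsto_nhds_limUnder
  unfold Udet
  exact ⟨_, (tendsto_finsetSum _ fun t _ => ((hL t).sub (hK _)).const_mul _).const_mul _⟩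

lemma exists_abs_Udet_le (hFb : ∃ M : ℝ, ∀ y, |F y| ≤ M) :
    ∃ C : ℝ, ∀ v y, |Udet p n x θ F v y| ≤ C := by
  obtain ⟨M, hM⟩ := hFb
  refine ⟨(1 / Real.sqrt n) * ∑ t ∈ Finset.Icc (1 : ℤ) (n : ℤ), (1 + M), fun v y => ?_⟩
  have hc : 0 ≤ 1 / Real.sqrt n := by positivity
  unfold Udet
  rw [abs_mul, abs_of_nonneg hc]
  refine mul_le_mul_of_nonneg_left ((Finset.abs_sum_le_sum_abs _ _).trans
    (Finset.sum_le_sum fun t _ => ?_)) hc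
  have h := abs_le.1 (hM (y - ∑ i : Fin p, θ i * x (t - 1 - (i : ℤ))))
  rw [abs_le]
  split_ifs <;> constructor <;> linarith

/-- `Udet` is nonincreasing in `y` between consecutive sample values. -/
lemma Udet_le_of_forall_notMem_Ioc (hF : Monotone F) (v : Fin p → ℝ) {y z : ℝ} (hyz : y ≤ z)
    (h : ∀ t : ℤ, 1 ≤ t → t ≤ n → x t ∉ Set.Ioc y z) :
    Udet p n x θ F v z ≤ Udet p n x θ F v y := by
  unfold Udet
  refine mul_le_mul_of_nonneg_left (Finset.sum_le_sum fun t ht => ?_) (by positivity)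
  obtain ⟨h1, h2⟩ := Finset.mem_Icc.1 ht
  refine mul_le_mul_of_nonneg_left (sub_le_sub ?_ (hF (by linarith))) (by split_ifs <;> simp)
  have := h t h1 h2
  split_ifs with hz hy
  · exact le_rfl
  · exact absurd ⟨not_le.1 hy, hz⟩ this
  · exact zero_le_one
  · exact le_rfl

/-- Either `Udet` vanishes at `v`, or `v` can be replaced by a point of the sample grid. -/
lemma Udet_eq_zero_or_exists_grid (v : Fin p → ℝ) :
    (∀ y, Udet p n x θ F v y = 0) ∨ ∃ w : Fin p → ℝ,
      (∀ i : Fin p, ∃ t : ℤ, 1 ≤ t ∧ t ≤ n ∧ w i = x (t - 1 - (i : ℤ))) ∧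
      ∀ y, Udet p n x θ F v y = Udet p n x θ F w y := by
  by_cases h : ∀ i : Fin p, ∃ t ∈ Finset.Icc (1 : ℤ) n, x (t - 1 - (i : ℤ)) ≤ v i
  · right
    have hmax : ∀ i : Fin p, ∃ t ∈ Finset.Icc (1 : ℤ) n, x (t - 1 - (i : ℤ)) ≤ v i ∧
        ∀ s ∈ Finset.Icc (1 : ℤ) n, x (s - 1 - (i : ℤ)) ≤ v i →
          x (s - 1 - (i : ℤ)) ≤ x (t - 1 - (i : ℤ)) := by
      intro i
      obtain ⟨t₀, ht₀, hle₀⟩ := h i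
      obtain ⟨t, ht, hmax⟩ := ((Finset.Icc (1 : ℤ) n).filter
        (fun t => x (t - 1 - (i : ℤ)) ≤ v i)).exists_max_image (fun t => x (t - 1 - (i : ℤ)))
        ⟨t₀, Finset.mem_filter.2 ⟨ht₀, hle₀⟩⟩
      obtain ⟨ht, hle⟩ := Finset.mem_filter.1 ht
      exact ⟨t, ht, hle, fun s hs hsv => hmax s (Finset.mem_filter.2 ⟨hs, hsv⟩)⟩
    choose τ hτ hle hτmax using hmax
    refine ⟨fun i => x (τ i - 1 - (i : ℤ)), fun i => ⟨τ i, (Finset.mem_Icc.1 (hτ i)).1,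
      (Finset.mem_Icc.1 (hτ i)).2, rfl⟩, fun y => ?_⟩
    unfold Udet
    congr 1
    refine Finset.sum_congr rfl fun t ht => ?_
    congr 1
    exact if_congr ⟨fun hv i => hτmax i t ht (hv i), fun hw i => (hw i).trans (hle i)⟩ rfl rfl
  · left
    intro y
    push Not at h
    obtain ⟨i, hi⟩ := h
    unfold Udet
    rw [Finset.sum_eq_zero, mul_zero]
    intro t ht
    rw [if_neg fun hv => (hi t ht).not_ge (hv i), zero_mul]

/-- Any bound for `|Udet|` at the sample values, and for its left limits there and its limits at
`±∞`, is a bound everywhere. -/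
lemma abs_Udet_le_of_extremal (hF : Monotone F) (hFb : ∃ M : ℝ, ∀ y, |F y| ≤ M)
    (v : Fin p → ℝ) {C : ℝ}
    (hval : ∀ t : ℤ, 1 ≤ t → t ≤ n → |Udet p n x θ F v (x t)| ≤ C)
    (hleft : ∀ t : ℤ, 1 ≤ t → t ≤ n →
      |limUnder (𝓝[<] (x t)) (fun y => Udet p n x θ F v y)| ≤ C)
    (htop : |limUnder atTop (fun y => Udet p n x θ F v y)| ≤ C)
    (hbot : |limUnder atBot (fun y => Udet p n x θ F v y)| ≤ C) (y : ℝ) :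
    |Udet p n x θ F v y| ≤ C := by
  rw [abs_le]
  constructor
  · by_cases h : ((Finset.Icc (1 : ℤ) n).filter (fun t => y < x t)).Nonempty
    · obtain ⟨b, hb, hmin⟩ := Finset.exists_min_image _ x h
      simp only [Finset.mem_filter, Finset.mem_Icc] at hb hmin
      refine (abs_le.1 (hleft b hb.1.1 hb.1.2)).1.trans
        (le_of_tendsto (tendsto_Udet_limUnder hF hFb (hasMonotoneLimits_nhdsLT _) v) ?_)
      filter_upwards [Ioo_mem_nhdsLT hb.2] with z hz
      exact Udet_le_of_forall_notMem_Ioc hF v hz.1.le fun t h1 h2 ht =>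
        (hmin t ⟨⟨h1, h2⟩, ht.1⟩).not_gt (ht.2.trans_lt hz.2)
    · refine (abs_le.1 htop).1.trans
        (le_of_tendsto (tendsto_Udet_limUnder hF hFb hasMonotoneLimits_atTop v) ?_)
      filter_upwards [eventually_ge_atTop y] with z hz
      exact Udet_le_of_forall_notMem_Ioc hF v hz fun t h1 h2 ht =>
        h ⟨t, Finset.mem_filter.2 ⟨Finset.mem_Icc.2 ⟨h1, h2⟩, ht.1⟩⟩
  · by_cases h : ((Finset.Icc (1 : ℤ) n).filter (fun t => x t ≤ y)).Nonempty
    · obtain ⟨a, ha, hmax⟩ := Finset.exists_max_image _ x h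
      simp only [Finset.mem_filter, Finset.mem_Icc] at ha hmax
      refine le_trans ?_ (abs_le.1 (hval a ha.1.1 ha.1.2)).2
      exact Udet_le_of_forall_notMem_Ioc hF v ha.2 fun t h1 h2 ht =>
        (hmax t ⟨⟨h1, h2⟩, ht.2⟩).not_gt ht.1
    · refine le_trans
        (ge_of_tendsto (tendsto_Udet_limUnder hF hFb hasMonotoneLimits_atBot v) ?_)
        (abs_le.1 hbot).2
      filter_upwards [eventually_le_atBot y] with z hz
      exact Udet_le_of_forall_notMem_Ioc hF v hz fun t h1 h2 ht =>
        h ⟨t, Finset.mem_filter.2 ⟨Finset.mem_Icc.2 ⟨h1, h2⟩, ht.2⟩⟩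

end Udet

/-- The supremum of `|U_n|` over `ℝ^p × ℝ` is attained on a finite grid: it equals the
maximum of `0`, the values `|U_n(v, x_t)|`, the left limits `|lim_{y↑x_t} U_n(v, y)|`
(`t = 1,…,n`), and the limits `|lim_{y→±∞} U_n(v, y)|`, where `v` ranges over the grid
`{x₀,…,x_{n−1}} × {x_{−1},…,x_{n−2}} × ⋯ × {x_{1−p},…,x_{n−p}}`. -/
theorem sup_Udet_on_grid
    (p n : ℕ) (hp : 1 ≤ p) (hn : 1 ≤ n) (x : ℤ → ℝ) (θ : Fin p → ℝ) (F : ℝ → ℝ)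
    (hFmono : Monotone F) (hFbdd : ∃ M : ℝ, ∀ y, |F y| ≤ M)
    (hFrc : ∀ y, ContinuousWithinAt F (Set.Ici y) y) :
    (⨆ (v : Fin p → ℝ) (y : ℝ), |Udet p n x θ F v y|)
      = sSup (insert (0 : ℝ)
          ({c : ℝ | ∃ v : Fin p → ℝ,
              (∀ i : Fin p, ∃ t : ℤ, 1 ≤ t ∧ t ≤ n ∧ v i = x (t - 1 - (i : ℤ))) ∧
              ∃ t : ℤ, 1 ≤ t ∧ t ≤ n ∧
                (c = |Udet p n x θ F v (x t)|
                  ∨ c = |limUnder (𝓝[<] (x t)) (fun y => Udet p n x θ F v y)|)}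
            ∪ {c : ℝ | ∃ v : Fin p → ℝ,
                (∀ i : Fin p, ∃ t : ℤ, 1 ≤ t ∧ t ≤ n ∧ v i = x (t - 1 - (i : ℤ))) ∧
                (c = |limUnder atTop (fun y => Udet p n x θ F v y)|
                  ∨ c = |limUnder atBot (fun y => Udet p n x θ F v y)|)})) := by
  obtain ⟨C, hC⟩ := exists_abs_Udet_le (p := p) (n := n) (x := x) (θ := θ) hFbdd
  have hlim : ∀ (l : Filter ℝ) [l.NeBot], HasMonotoneLimits l → ∀ (v : Fin p → ℝ) (B : ℝ),
      (∀ y, |Udet p n x θ F v y| ≤ B) →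
      |limUnder l (fun y => Udet p n x θ F v y)| ≤ B := fun l _ hl v B hB =>
    le_of_tendsto (tendsto_Udet_limUnder hFmono hFbdd hl v).abs (Eventually.of_forall hB)
  have hset : ∀ B : ℝ, 0 ≤ B → (∀ v y, |Udet p n x θ F v y| ≤ B) → ∀ c ∈ insert (0 : ℝ)
          ({c : ℝ | ∃ v : Fin p → ℝ,
              (∀ i : Fin p, ∃ t : ℤ, 1 ≤ t ∧ t ≤ n ∧ v i = x (t - 1 - (i : ℤ))) ∧
              ∃ t : ℤ, 1 ≤ t ∧ t ≤ n ∧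
                (c = |Udet p n x θ F v (x t)|
                  ∨ c = |limUnder (𝓝[<] (x t)) (fun y => Udet p n x θ F v y)|)}
            ∪ {c : ℝ | ∃ v : Fin p → ℝ,
                (∀ i : Fin p, ∃ t : ℤ, 1 ≤ t ∧ t ≤ n ∧ v i = x (t - 1 - (i : ℤ))) ∧
                (c = |limUnder atTop (fun y => Udet p n x θ F v y)|
                  ∨ c = |limUnder atBot (fun y => Udet p n x θ F v y)|)}), c ≤ B := by
    rintro B hB0 hB c (rfl | ⟨v, -, t, -, -, rfl | rfl⟩ | ⟨v, -, rfl | rfl⟩)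
    · exact hB0
    · exact hB _ _
    · exact hlim _ (hasMonotoneLimits_nhdsLT _) v B (hB v)
    · exact hlim _ hasMonotoneLimits_atTop v B (hB v)
    · exact hlim _ hasMonotoneLimits_atBot v B (hB v)
  have hbdd := hset C ((abs_nonneg _).trans (hC 0 0)) hC
  apply le_antisymm
  · refine ciSup_le fun v => ciSup_le fun y => ?_
    obtain h0 | ⟨w, hw, hvw⟩ := Udet_eq_zero_or_exists_grid (n := n) (x := x) (θ := θ) (F := F) v
    · rw [h0, abs_zero]
      exact le_csSup ⟨C, hbdd⟩ (Set.mem_insert _ _)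
    · rw [hvw]
      exact abs_Udet_le_of_extremal hFmono hFbdd w
        (fun t h1 h2 => le_csSup ⟨C, hbdd⟩ (Or.inr (Or.inl ⟨w, hw, t, h1, h2, Or.inl rfl⟩)))
        (fun t h1 h2 => le_csSup ⟨C, hbdd⟩ (Or.inr (Or.inl ⟨w, hw, t, h1, h2, Or.inr rfl⟩)))
        (le_csSup ⟨C, hbdd⟩ (Or.inr (Or.inr ⟨w, hw, Or.inl rfl⟩)))
        (le_csSup ⟨C, hbdd⟩ (Or.inr (Or.inr ⟨w, hw, Or.inr rfl⟩))) y
  · refine csSup_le (Set.insert_nonempty _ _) (hset _ ?_ fun v y => ?_)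
    · exact Real.iSup_nonneg fun v => Real.iSup_nonneg fun y => abs_nonneg _
    · refine (le_ciSup (f := fun y => |Udet p n x θ F v y|) ⟨C, ?_⟩ y).trans
        (le_ciSup (f := fun v => ⨆ y, |Udet p n x θ F v y|) ⟨C, ?_⟩ v)
      · rintro _ ⟨z, rfl⟩
        exact hC v z
      · rintro _ ⟨w, rfl⟩
        exact ciSup_le (hC w)
end
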